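/- arXiv:2007.06738 — 2 statements merged into one kernel-verified Lean document; each statement's English description precedes it below -/
import Mathlib

section
/- Suppose D > 2, log(1/ε(α)) = ω(α^D) as α → ∞, and the stability condition holds. Then ŵ is a minimizer of ‖w‖₁ over w ∈ ℝ^d subject to x_nᵀw ≥ 1 for all n ∈ {1,…,N}. -/
open Real Finset Filter Topology MeasureTheory

/-- If `f' ≤ g'` on `[a, b]`, the increment of `f` is at most the increment of `g`. -/
lemma sub_le_sub_of_hasDerivAt_le {f g f' g' : ℝ → ℝ} {a b : ℝ} (hab : a ≤ b)
    (hf : ∀ t ∈ Set.Icc a b, HasDerivAt f (f' t) t)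
    (hg : ∀ t ∈ Set.Icc a b, HasDerivAt g (g' t) t)
    (hle : ∀ t ∈ Set.Icc a b, f' t ≤ g' t) : f b - f a ≤ g b - g a := by
  have hd : ∀ t ∈ Set.Icc a b, HasDerivAt (fun s => g s - f s) (g' t - f' t) t :=
    fun t ht => (hg t ht).sub (hf t ht)
  have hmono : MonotoneOn (fun s => g s - f s) (Set.Icc a b) := by
    apply monotoneOn_of_deriv_nonneg (convex_Icc a b)
    · exact fun t ht => (hd t ht).continuousAt.continuousWithinAt
    · exact fun t ht => (hd t (interior_subset ht)).differentiableAt.differentiableWithinAt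
    · intro t ht
      rw [(hd t (interior_subset ht)).deriv]
      exact sub_nonneg.2 (hle t (interior_subset ht))
  have := hmono (Set.left_mem_Icc.2 hab) (Set.right_mem_Icc.2 hab) hab
  simp only at this
  linarith

/-- The primitive on `[0, ∞)` of a function that is only known to be regular there. -/
noncomputable def primitive (b : ℝ → ℝ) (t : ℝ) : ℝ := ∫ τ in (0 : ℝ)..t, b (max τ 0)

lemma primitive_zero (b : ℝ → ℝ) : primitive b 0 = 0 := by simp [primitive]

lemma hasDerivAt_primitive {b : ℝ → ℝ} (hb : ∀ t, 0 ≤ t → ContinuousAt b t) {t : ℝ}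
    (ht : 0 ≤ t) : HasDerivAt (primitive b) (b t) t := by
  have hc : Continuous fun τ => b (max τ 0) := by
    rw [continuous_iff_continuousAt]
    intro τ
    exact ContinuousAt.comp (f := fun τ => max τ 0) (hb _ (le_max_right _ _)) (by fun_prop)
  have := intervalIntegral.integral_hasDerivAt_right (hc.intervalIntegrable 0 t)
    (hc.stronglyMeasurableAtFilter _ _) hc.continuousAt
  simp only [max_eq_left ht] at this
  exact this

lemma primitive_nonneg {b : ℝ → ℝ} (hb : ∀ t, 0 ≤ b t) {t : ℝ} (ht : 0 ≤ t) :
    0 ≤ primitive b t :=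
  intervalIntegral.integral_nonneg ht fun _ _ => hb _

/-- Solutions of a scalar linear equation keep the sign of their initial value. -/
lemma pos_of_hasDerivAt_mul_self {u b : ℝ → ℝ} (hb : ∀ t, 0 ≤ t → ContinuousAt b t)
    (hu : ∀ t, 0 ≤ t → HasDerivAt u (b t * u t) t) (h0 : 0 < u 0) {t : ℝ} (ht : 0 ≤ t) :
    0 < u t := by
  have hd : ∀ s ∈ Set.Icc 0 t,
      HasDerivAt (fun s => u s * exp (-primitive b s)) ((fun _ => 0) s) s := by
    intro s hs
    have h := (hu s hs.1).mul (hasDerivAt_primitive hb hs.1).neg.exp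
    exact h.congr_deriv (by simp only; ring)
  have h0' : ∀ s ∈ Set.Icc 0 t, HasDerivAt (fun _ : ℝ => (0 : ℝ)) ((fun _ => 0) s) s :=
    fun s _ => hasDerivAt_const s 0
  have h := sub_le_sub_of_hasDerivAt_le ht h0' hd fun _ _ => le_rfl
  simp only [primitive_zero, neg_zero, exp_zero, mul_one, sub_self] at h
  have : 0 < u t * exp (-primitive b t) := by linarith
  exact pos_of_mul_pos_left this (exp_pos _).le

section Coordinate

variable {α p m η : ℝ} {s : ℕ}

lemma abs_lt_one_of_div_pow (hα : 0 < α) (hp : 0 < p) (hm : 0 < m)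
    (h1 : (α / p) ^ s = 1 - η) (h2 : (α / m) ^ s = 1 + η) : |η| < 1 := by
  have := pow_pos (div_pos hα hp) s
  have := pow_pos (div_pos hα hm) s
  rw [abs_lt]
  constructor <;> linarith

lemma pow_le_pow_add_pow_of_div_pow (hα : 0 < α) (hp : 0 < p) (hm : 0 < m)
    (h1 : (α / p) ^ s = 1 - η) (h2 : (α / m) ^ s = 1 + η) (hs : s ≠ 0) (k : ℕ) :
    α ^ k ≤ p ^ k + m ^ k := by
  have hpk := pow_pos hp k
  have hmk := pow_pos hm k
  by_cases hpα : α ≤ p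
  · have := pow_le_pow_left₀ hα.le hpα k
    linarith
  by_cases hmα : α ≤ m
  · have := pow_le_pow_left₀ hα.le hmα k
    linarith
  push Not at hpα hmα
  have := one_lt_pow₀ ((one_lt_div hp).2 hpα) hs
  have := one_lt_pow₀ ((one_lt_div hm).2 hmα) hs
  linarith

lemma abs_weight_le_aux (hα : 0 < α) (hp : 0 < p) (hm : 0 < m)
    (h1 : (α / p) ^ s = 1 - η) (h2 : (α / m) ^ s = 1 + η) (hs : s ≠ 0) (hη : 0 ≤ η)
    {M : ℝ} (hM : 1 ≤ M) :
    (1 - 1 / M) * |p ^ (s + 2) - m ^ (s + 2)| ≤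
      M ^ 2 * α ^ (s + 2) + η * (p ^ (s + 2) - m ^ (s + 2)) := by
  have hM0 : 0 < M := by linarith
  have hαp : α ≤ p := by
    by_contra! h
    have := one_lt_pow₀ ((one_lt_div hp).2 h) hs
    linarith
  have hmα : m ≤ α := by
    by_contra! h
    have := pow_lt_one₀ (div_pos hα hm).le ((div_lt_one hm).2 h) hs
    linarith
  have hw : 0 ≤ p ^ (s + 2) - m ^ (s + 2) :=
    sub_nonneg.2 (pow_le_pow_left₀ hm.le (hmα.trans hαp) _)
  have hm' := pow_pos hm (s + 2)
  rw [abs_of_nonneg hw]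
  have h0 : 0 ≤ 1 - η := h1 ▸ (pow_pos (div_pos hα hp) s).le
  suffices H : (p ^ (s + 2) - m ^ (s + 2)) * (1 - η) ≤
      M ^ 2 * α ^ (s + 2) + (p ^ (s + 2) - m ^ (s + 2)) * (1 / M) by linarith
  by_cases hpM : p ≤ M * α
  · have e1 : (p ^ (s + 2) - m ^ (s + 2)) * (1 - η) ≤ p ^ (s + 2) * (1 - η) :=
      mul_le_mul_of_nonneg_right (by linarith) h0
    have e2 : p ^ (s + 2) * (1 - η) = α ^ s * p ^ 2 := by
      rw [← h1, div_pow, pow_add]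
      field_simp
    have e3 : α ^ s * p ^ 2 ≤ α ^ s * (M * α) ^ 2 := by gcongr
    have e4 : α ^ s * (M * α) ^ 2 = M ^ 2 * α ^ (s + 2) := by ring
    have e5 : 0 ≤ (p ^ (s + 2) - m ^ (s + 2)) * (1 / M) := by positivity
    linarith
  · push Not at hpM
    have e1 : 1 - η ≤ 1 / M := by
      rw [← h1]
      refine (pow_le_of_le_one (div_pos hα hp).le ((div_le_one hp).2 hαp) hs).trans ?_
      rw [div_le_div_iff₀ hp hM0]
      linarith
    have e2 := mul_le_mul_of_nonneg_left e1 hw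
    have e3 : 0 < M ^ 2 * α ^ (s + 2) := by positivity
    linarith

lemma abs_weight_le (hα : 0 < α) (hp : 0 < p) (hm : 0 < m)
    (h1 : (α / p) ^ s = 1 - η) (h2 : (α / m) ^ s = 1 + η) (hs : s ≠ 0)
    {M : ℝ} (hM : 1 ≤ M) :
    (1 - 1 / M) * |p ^ (s + 2) - m ^ (s + 2)| ≤
      M ^ 2 * α ^ (s + 2) + η * (p ^ (s + 2) - m ^ (s + 2)) := by
  rcases le_total 0 η with h | h
  · exact abs_weight_le_aux hα hp hm h1 h2 hs h hM
  · have := abs_weight_le_aux (η := -η) hα hm hp (by linarith) (by linarith) hs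
      (by linarith) hM
    rw [abs_sub_comm]
    linarith

end Coordinate

/-- The gradient flow of a diagonal linear network of depth `s + 2` with weights `p`, `m`,
initialized at `α`; `w` is the induced linear predictor. -/
structure DiagFlow {d N : ℕ} (x : Fin N → Fin d → ℝ) (s : ℕ) (α : ℝ)
    (p m w : ℝ → Fin d → ℝ) : Prop where
  init_p : ∀ i, p 0 i = α
  init_m : ∀ i, m 0 i = α
  weight : ∀ t i, w t i = p t i ^ (s + 2) - m t i ^ (s + 2)
  deriv_p : ∀ t, 0 ≤ t → ∀ i, HasDerivAt (fun τ => p τ i)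
    ((((s + 2 : ℕ) : ℝ) / N) * p t i ^ (s + 1) *
      ∑ n, exp (-(∑ j, x n j * w t j)) * x n i) t
  deriv_m : ∀ t, 0 ≤ t → ∀ i, HasDerivAt (fun τ => m τ i)
    (-((((s + 2 : ℕ) : ℝ) / N) * m t i ^ (s + 1) *
      ∑ n, exp (-(∑ j, x n j * w t j)) * x n i)) t

/-- The exponential loss of the linear predictor `w`. -/
noncomputable def expLoss {d N : ℕ} (x : Fin N → Fin d → ℝ) (w : Fin d → ℝ) : ℝ :=
  (1 / (N : ℝ)) * ∑ n, exp (-(∑ i, x n i * w i))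

/-- The rescaled time integral of the exponential residuals. -/
noncomputable def dualVar {d N : ℕ} (x : Fin N → Fin d → ℝ) (s : ℕ) (α : ℝ)
    (w : ℝ → Fin d → ℝ) (t : ℝ) (n : Fin N) : ℝ :=
  α ^ s * (((s + 2 : ℕ) : ℝ) / N * s) * primitive (fun τ => exp (-(∑ j, x n j * w τ j))) t

lemma expLoss_pos {d N : ℕ} (hN : 0 < N) (x : Fin N → Fin d → ℝ) (w : Fin d → ℝ) :
    0 < expLoss x w := by
  have : Nonempty (Fin N) := ⟨⟨0, hN⟩⟩
  have : (0 : ℝ) < N := by exact_mod_cast hN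
  have : 0 < ∑ n, exp (-(∑ i, x n i * w i)) :=
    Finset.sum_pos (fun _ _ => exp_pos _) Finset.univ_nonempty
  unfold expLoss
  positivity

lemma exp_neg_margin_le {d N : ℕ} (hN : 0 < N) (x : Fin N → Fin d → ℝ) (w : Fin d → ℝ)
    (n : Fin N) : exp (-(∑ i, x n i * w i)) ≤ N * expLoss x w := by
  have hN' : (N : ℝ) ≠ 0 := by exact_mod_cast hN.ne'
  have : (N : ℝ) * expLoss x w = ∑ n, exp (-(∑ i, x n i * w i)) := by
    unfold expLoss
    field_simp
  rw [this]
  exact Finset.single_le_sum (f := fun n => exp (-(∑ i, x n i * w i)))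
    (fun _ _ => (exp_pos _).le) (Finset.mem_univ n)

lemma neg_log_expLoss_le_margin {d N : ℕ} (hN : 0 < N) (x : Fin N → Fin d → ℝ)
    (w : Fin d → ℝ) (n : Fin N) : -log (expLoss x w) - log N ≤ ∑ i, x n i * w i := by
  have hN' : (N : ℝ) ≠ 0 := by exact_mod_cast hN.ne'
  have := log_le_log (exp_pos _) (exp_neg_margin_le hN x w n)
  rw [log_exp, log_mul hN' (expLoss_pos hN x w).ne'] at this
  linarith

namespace DiagFlow

variable {d N s : ℕ} {x : Fin N → Fin d → ℝ} {α : ℝ} {p m w : ℝ → Fin d → ℝ}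

lemma hasDerivAt_w (F : DiagFlow x s α p m w) {t : ℝ} (ht : 0 ≤ t) (i : Fin d) :
    HasDerivAt (fun τ => w τ i)
      (((s + 2 : ℕ) : ℝ) ^ 2 * ((1 / (N : ℝ)) * ∑ n, exp (-(∑ j, x n j * w t j)) * x n i) *
        (p t i ^ (2 * s + 2) + m t i ^ (2 * s + 2))) t := by
  have h := ((F.deriv_p t ht i).pow (s + 2)).sub ((F.deriv_m t ht i).pow (s + 2))
  have e : (fun τ => w τ i) =
      (fun τ => p τ i) ^ (s + 2) - (fun τ => m τ i) ^ (s + 2) := by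
    funext τ
    simp [F.weight]
  rw [e]
  refine h.congr_deriv ?_
  simp only [Nat.add_succ_sub_one]
  ring

lemma continuousAt_residual (F : DiagFlow x s α p m w) {t : ℝ} (ht : 0 ≤ t) (n : Fin N) :
    ContinuousAt (fun τ => exp (-(∑ j, x n j * w τ j))) t := by
  have (j : Fin d) : ContinuousAt (fun τ => w τ j) t := (F.hasDerivAt_w ht j).continuousAt
  fun_prop

lemma p_pos (F : DiagFlow x s α p m w) (hα : 0 < α) {t : ℝ} (ht : 0 ≤ t)
    (i : Fin d) : 0 < p t i := by
  refine pos_of_hasDerivAt_mul_self (u := fun τ => p τ i)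
    (b := fun τ => (((s + 2 : ℕ) : ℝ) / N) * p τ i ^ s *
      ∑ n, exp (-(∑ j, x n j * w τ j)) * x n i) ?_ ?_ (by simpa [F.init_p] using hα) ht
  · intro τ hτ
    have := (F.deriv_p τ hτ i).continuousAt
    have := fun n => F.continuousAt_residual hτ n
    fun_prop
  · intro τ hτ
    convert F.deriv_p τ hτ i using 1
    ring

lemma m_pos (F : DiagFlow x s α p m w) (hα : 0 < α) {t : ℝ} (ht : 0 ≤ t)
    (i : Fin d) : 0 < m t i := by
  refine pos_of_hasDerivAt_mul_self (u := fun τ => m τ i)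
    (b := fun τ => -((((s + 2 : ℕ) : ℝ) / N) * m τ i ^ s *
      ∑ n, exp (-(∑ j, x n j * w τ j)) * x n i)) ?_ ?_ (by simpa [F.init_m] using hα) ht
  · intro τ hτ
    have := (F.deriv_m τ hτ i).continuousAt
    have := fun n => F.continuousAt_residual hτ n
    fun_prop
  · intro τ hτ
    convert F.deriv_m τ hτ i using 1
    ring

lemma hasDerivAt_dualVar (F : DiagFlow x s α p m w) {t : ℝ} (ht : 0 ≤ t) (n : Fin N) :
    HasDerivAt (fun τ => dualVar x s α w τ n)
      (α ^ s * (((s + 2 : ℕ) : ℝ) / N * s) * exp (-(∑ j, x n j * w t j))) t :=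
  (hasDerivAt_primitive (fun _ hτ => F.continuousAt_residual hτ n) ht).const_mul _

lemma dualVar_zero (n : Fin N) : dualVar x s α w 0 n = 0 := by
  simp [dualVar, primitive_zero]

lemma dualVar_nonneg (hα : 0 < α) {t : ℝ} (ht : 0 ≤ t) (n : Fin N) :
    0 ≤ dualVar x s α w t n := by
  have := primitive_nonneg (b := fun τ => exp (-(∑ j, x n j * w τ j)))
    (fun _ => (exp_pos _).le) ht
  unfold dualVar
  positivity

/-- Along an equation `u' = c u^(s+1)`, the quantity `(α / u)^s` moves with velocity
`-α^s s c`. -/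
lemma hasDerivAt_div_pow {u : ℝ → ℝ} {c t : ℝ} (hs : s ≠ 0) (hu : 0 < u t)
    (h : HasDerivAt u (c * u t ^ (s + 1)) t) :
    HasDerivAt (fun τ => (α / u τ) ^ s) (-(α ^ s * s * c)) t := by
  have h' := ((h.pow s).inv (pow_pos hu s).ne').const_mul (α ^ s)
  have e : (fun τ => (α / u τ) ^ s) = fun τ => α ^ s * ((u ^ s)⁻¹) τ := by
    funext τ
    rw [div_pow, div_eq_mul_inv, Pi.inv_apply, Pi.pow_apply]
  rw [e]
  refine h'.congr_deriv ?_
  obtain ⟨k, rfl⟩ := Nat.exists_eq_succ_of_ne_zero hs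
  simp only [Nat.succ_eq_add_one, Nat.add_sub_cancel]
  have := hu.ne'
  simp only [Pi.pow_apply]
  field_simp
  ring

lemma div_p_pow (F : DiagFlow x s α p m w) (hα : 0 < α) (hs : s ≠ 0) {t : ℝ} (ht : 0 ≤ t)
    (i : Fin d) : (α / p t i) ^ s = 1 - ∑ n, dualVar x s α w t n * x n i := by
  have h1 : ∀ τ ∈ Set.Icc 0 t, HasDerivAt (fun τ => (α / p τ i) ^ s)
      ((fun τ => -(α ^ s * s * ((((s + 2 : ℕ) : ℝ) / N) *
        ∑ n, exp (-(∑ j, x n j * w τ j)) * x n i))) τ) τ := by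
    intro τ hτ
    refine hasDerivAt_div_pow hs (F.p_pos hα hτ.1 i) ?_
    convert F.deriv_p τ hτ.1 i using 1
    ring
  have h2 : ∀ τ ∈ Set.Icc 0 t,
      HasDerivAt (fun τ => 1 - ∑ n, dualVar x s α w τ n * x n i)
      ((fun τ => -(α ^ s * s * ((((s + 2 : ℕ) : ℝ) / N) *
        ∑ n, exp (-(∑ j, x n j * w τ j)) * x n i))) τ) τ := by
    intro τ hτ
    refine ((HasDerivAt.fun_sum fun n (_ : n ∈ Finset.univ) =>
      (F.hasDerivAt_dualVar hτ.1 n).mul_const (x n i)).const_sub 1).congr_deriv ?_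
    simp only [Finset.mul_sum]
    congr 1
    exact Finset.sum_congr rfl fun n _ => by ring
  have e1 := sub_le_sub_of_hasDerivAt_le ht h1 h2 fun _ _ => le_rfl
  have e2 := sub_le_sub_of_hasDerivAt_le ht h2 h1 fun _ _ => le_rfl
  simp only [F.init_p, div_self hα.ne', one_pow, dualVar_zero, zero_mul,
    Finset.sum_const_zero] at e1 e2
  linarith

lemma div_m_pow (F : DiagFlow x s α p m w) (hα : 0 < α) (hs : s ≠ 0) {t : ℝ} (ht : 0 ≤ t)
    (i : Fin d) : (α / m t i) ^ s = 1 + ∑ n, dualVar x s α w t n * x n i := by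
  have h1 : ∀ τ ∈ Set.Icc 0 t, HasDerivAt (fun τ => (α / m τ i) ^ s)
      ((fun τ => -(α ^ s * s * (-((((s + 2 : ℕ) : ℝ) / N) *
        ∑ n, exp (-(∑ j, x n j * w τ j)) * x n i)))) τ) τ := by
    intro τ hτ
    refine hasDerivAt_div_pow hs (F.m_pos hα hτ.1 i) ?_
    convert F.deriv_m τ hτ.1 i using 1
    ring
  have h2 : ∀ τ ∈ Set.Icc 0 t,
      HasDerivAt (fun τ => 1 + ∑ n, dualVar x s α w τ n * x n i)
      ((fun τ => -(α ^ s * s * (-((((s + 2 : ℕ) : ℝ) / N) *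
        ∑ n, exp (-(∑ j, x n j * w τ j)) * x n i)))) τ) τ := by
    intro τ hτ
    refine ((HasDerivAt.fun_sum fun n (_ : n ∈ Finset.univ) =>
      (F.hasDerivAt_dualVar hτ.1 n).mul_const (x n i)).const_add 1).congr_deriv ?_
    simp only [mul_neg, neg_neg, Finset.mul_sum]
    exact Finset.sum_congr rfl fun n _ => by ring
  have e1 := sub_le_sub_of_hasDerivAt_le ht h1 h2 fun _ _ => le_rfl
  have e2 := sub_le_sub_of_hasDerivAt_le ht h2 h1 fun _ _ => le_rfl
  simp only [F.init_m, div_self hα.ne', one_pow, dualVar_zero, zero_mul,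
    Finset.sum_const_zero] at e1 e2
  linarith

/-- The dual variables are bounded by the `ℓ¹` norm of any feasible vector. -/
lemma sum_dualVar_le (F : DiagFlow x s α p m w) (hα : 0 < α) (hs : s ≠ 0) {t : ℝ}
    (ht : 0 ≤ t) {v : Fin d → ℝ} (hv : ∀ n, 1 ≤ ∑ i, x n i * v i) :
    ∑ n, dualVar x s α w t n ≤ ∑ i, |v i| := by
  calc ∑ n, dualVar x s α w t n
      ≤ ∑ n, dualVar x s α w t n * ∑ i, x n i * v i :=
        Finset.sum_le_sum fun n _ => le_mul_of_one_le_right (dualVar_nonneg hα ht n) (hv n)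
    _ = ∑ i, (∑ n, dualVar x s α w t n * x n i) * v i := by
        simp only [Finset.mul_sum, Finset.sum_mul, mul_assoc]
        exact Finset.sum_comm
    _ ≤ ∑ i, |v i| := by
        refine Finset.sum_le_sum fun i _ => (le_abs_self _).trans ?_
        rw [abs_mul]
        exact mul_le_of_le_one_left (abs_nonneg _) (abs_lt_one_of_div_pow hα
          (F.p_pos hα ht i) (F.m_pos hα ht i) (F.div_p_pow hα hs ht i)
          (F.div_m_pow hα hs ht i)).le

lemma l1_le (F : DiagFlow x s α p m w) (hα : 0 < α) (hs : s ≠ 0) {t : ℝ}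
    (ht : 0 ≤ t) {M : ℝ} (hM : 1 ≤ M) :
    (1 - 1 / M) * ∑ i, |w t i| ≤
      d * (M ^ 2 * α ^ (s + 2)) + ∑ n, dualVar x s α w t n * ∑ i, x n i * w t i := by
  have e : ∑ n, dualVar x s α w t n * ∑ i, x n i * w t i =
      ∑ i, (∑ n, dualVar x s α w t n * x n i) * w t i := by
    simp only [Finset.mul_sum, Finset.sum_mul, mul_assoc]
    exact Finset.sum_comm
  have e' : (d : ℝ) * (M ^ 2 * α ^ (s + 2)) = ∑ _i : Fin d, M ^ 2 * α ^ (s + 2) := by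
    simp
  rw [e, e', ← Finset.sum_add_distrib, Finset.mul_sum]
  refine Finset.sum_le_sum fun i _ => ?_
  rw [F.weight]
  exact abs_weight_le hα (F.p_pos hα ht i) (F.m_pos hα ht i) (F.div_p_pow hα hs ht i)
    (F.div_m_pow hα hs ht i) hs hM

/-- The logarithmic loss decreases at speed at least proportional to the loss. -/
lemma exists_hasDerivAt_neg_log_loss (F : DiagFlow x s α p m w) (hN : 0 < N) (hα : 0 < α)
    (hs : s ≠ 0) {g : ℝ} (hg : 0 < g) {v : Fin d → ℝ} (hv : ∑ i, v i ^ 2 = 1)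
    (hgv : ∀ n, g ≤ ∑ i, x n i * v i) {t : ℝ} (ht : 0 ≤ t) :
    ∃ l' : ℝ, HasDerivAt (fun τ => -log (expLoss x (w τ))) l' t ∧
      g ^ 2 * α ^ (2 * s + 2) * expLoss x (w t) ≤ l' := by
  have hL := expLoss_pos hN x (w t)
  set G : Fin d → ℝ := fun i => (1 / (N : ℝ)) * ∑ n, exp (-(∑ j, x n j * w t j)) * x n i
    with hG
  set Q : Fin d → ℝ := fun i => p t i ^ (2 * s + 2) + m t i ^ (2 * s + 2) with hQ
  have hdL : HasDerivAt (fun τ => expLoss x (w τ))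
      (-∑ i, ((s + 2 : ℕ) : ℝ) ^ 2 * G i ^ 2 * Q i) t := by
    have h := (HasDerivAt.fun_sum fun n (_ : n ∈ Finset.univ) =>
      (HasDerivAt.fun_sum fun i (_ : i ∈ Finset.univ) =>
        (F.hasDerivAt_w ht i).const_mul (x n i)).neg.exp).const_mul (1 / (N : ℝ))
    refine h.congr_deriv ?_
    simp only [Pi.neg_apply, mul_neg, Finset.sum_neg_distrib, Finset.mul_sum]
    rw [Finset.sum_comm]
    congr 1
    refine Finset.sum_congr rfl fun i _ => ?_
    have : G i = ∑ n, (1 / (N : ℝ)) * (exp (-(∑ j, x n j * w t j)) * x n i) := by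
      simp only [hG, Finset.mul_sum]
    rw [sq (G i)]
    nth_rewrite 1 [this]
    simp only [Finset.mul_sum, Finset.sum_mul]
    refine Finset.sum_congr rfl fun n _ => ?_
    simp only [hG, hQ, Finset.mul_sum, Finset.sum_mul]
    refine Finset.sum_congr rfl fun n' _ => ?_
    ring
  refine ⟨_, (hdL.log hL.ne').neg, ?_⟩
  rw [neg_div, neg_neg, le_div_iff₀ hL]
  have hGv : g * expLoss x (w t) ≤ ∑ i, G i * v i := by
    have : ∑ i, G i * v i =
        (1 / (N : ℝ)) * ∑ n, exp (-(∑ j, x n j * w t j)) * ∑ i, x n i * v i := by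
      simp only [hG, Finset.mul_sum, Finset.sum_mul, mul_assoc]
      exact Finset.sum_comm
    rw [this, expLoss, mul_left_comm]
    refine mul_le_mul_of_nonneg_left ?_ (by positivity)
    rw [Finset.mul_sum]
    refine Finset.sum_le_sum fun n _ => ?_
    rw [mul_comm]
    exact mul_le_mul_of_nonneg_left (hgv n) (exp_pos _).le
  have hcs : (g * expLoss x (w t)) ^ 2 ≤ ∑ i, G i ^ 2 := by
    have h1 := Finset.sum_mul_sq_le_sq_mul_sq Finset.univ G v
    rw [hv, mul_one] at h1
    exact (pow_le_pow_left₀ (by positivity) hGv 2).trans h1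
  calc g ^ 2 * α ^ (2 * s + 2) * expLoss x (w t) * expLoss x (w t)
      = α ^ (2 * s + 2) * (g * expLoss x (w t)) ^ 2 := by ring
    _ ≤ α ^ (2 * s + 2) * ∑ i, G i ^ 2 := by gcongr
    _ ≤ ∑ i, ((s + 2 : ℕ) : ℝ) ^ 2 * G i ^ 2 * Q i := by
      rw [Finset.mul_sum]
      refine Finset.sum_le_sum fun i _ => ?_
      have hq : α ^ (2 * s + 2) ≤ Q i :=
        pow_le_pow_add_pow_of_div_pow hα (F.p_pos hα ht i) (F.m_pos hα ht i)
          (F.div_p_pow hα hs ht i) (F.div_m_pow hα hs ht i) hs _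
      have h1 : (1 : ℝ) ≤ ((s + 2 : ℕ) : ℝ) ^ 2 :=
        one_le_pow₀ (by push_cast; linarith [(Nat.cast_nonneg s : (0 : ℝ) ≤ s)])
      calc α ^ (2 * s + 2) * G i ^ 2 ≤ Q i * G i ^ 2 := by gcongr
        _ ≤ ((s + 2 : ℕ) : ℝ) ^ 2 * (Q i * G i ^ 2) :=
          le_mul_of_one_le_left
            (mul_nonneg ((pow_pos hα _).le.trans hq) (sq_nonneg _)) h1
        _ = _ := by ring

/-- The dual variable of a data point whose margin exceeds `ρ` times the minimal margin from
the loss level `exp (-B)` onwards is of order `(B + 1) / α ^ (s + 2)`. -/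
lemma dualVar_le (F : DiagFlow x s α p m w) (hN : 0 < N) (hα : 0 < α)
    (hs : s ≠ 0) {g : ℝ} (hg : 0 < g) {v : Fin d → ℝ} (hv : ∑ i, v i ^ 2 = 1)
    (hgv : ∀ n, g ≤ ∑ i, x n i * v i) {T : ℝ} (hT : 0 ≤ T) {ρ B : ℝ} (hρ : 1 < ρ)
    (hB : 0 ≤ B) (hBT : B ≤ -log (expLoss x (w T))) {k : Fin N}
    (hk : ∀ t ∈ Set.Icc 0 T, B ≤ -log (expLoss x (w t)) →
      -log (expLoss x (w t)) ≤ -log (expLoss x (w T)) →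
      ρ * (-log (expLoss x (w t)) - log N) ≤ ∑ i, x k i * w t i) :
    dualVar x s α w T k ≤ (((s + 2 : ℕ) : ℝ) / N * s) *
      (N * B + exp (ρ * log N) / (ρ - 1)) / (g ^ 2 * α ^ (s + 2)) := by
  have hN' : (0 : ℝ) < N := by exact_mod_cast hN
  have hρ' : 0 < ρ - 1 := by linarith
  set l : ℝ → ℝ := fun t => -log (expLoss x (w t)) with hl
  have hexists : ∀ t, ∃ l' : ℝ, 0 ≤ t → HasDerivAt l l' t ∧
      g ^ 2 * α ^ (2 * s + 2) * expLoss x (w t) ≤ l' := by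
    intro t
    by_cases ht : 0 ≤ t
    · obtain ⟨l', h⟩ := F.exists_hasDerivAt_neg_log_loss hN hα hs hg hv hgv ht
      exact ⟨l', fun _ => h⟩
    · exact ⟨0, fun h => absurd h ht⟩
  choose l' hl' using hexists
  set A : ℝ := g ^ 2 * α ^ (2 * s + 2) with hA
  have hA0 : 0 < A := by positivity
  have hLexp : ∀ t, expLoss x (w t) = exp (-l t) := by
    intro t
    rw [hl, neg_neg, exp_log (expLoss_pos hN x _)]
  have hl'0 : ∀ t, 0 ≤ t → 0 ≤ l' t := fun t ht =>
    (mul_pos hA0 (expLoss_pos hN x _)).le.trans (hl' t ht).2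
  have hmono : ∀ a b, 0 ≤ a → a ≤ b → l a ≤ l b := by
    intro a b ha hab
    have := sub_le_sub_of_hasDerivAt_le (f := fun _ => 0) (f' := fun _ => 0) hab
      (fun t _ => hasDerivAt_const t 0) (fun t ht => (hl' t (ha.trans ht.1)).1)
      (fun t ht => hl'0 t (ha.trans ht.1))
    linarith
  have hl0 : l 0 = 0 := by
    simp [hl, expLoss, F.weight, F.init_p, F.init_m, hN'.ne']
  obtain ⟨τ, hτ, hτB⟩ : B ∈ l '' Set.Icc 0 T :=
    intermediate_value_Icc hT
      (fun t ht => (hl' t ht.1).1.continuousAt.continuousWithinAt) ⟨hl0.trans_le hB, hBT⟩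
  set Λ := primitive fun τ => exp (-(∑ j, x k j * w τ j)) with hΛ
  have hdΛ : ∀ t, 0 ≤ t → HasDerivAt Λ (exp (-(∑ j, x k j * w t j))) t := fun t ht =>
    hasDerivAt_primitive (fun _ h => F.continuousAt_residual h k) ht
  have hphase1 : Λ τ - Λ 0 ≤ N / A * l τ - N / A * l 0 := by
    refine sub_le_sub_of_hasDerivAt_le (f' := fun t => exp (-(∑ j, x k j * w t j)))
      (g' := fun t => N / A * l' t) (g := fun t => N / A * l t) hτ.1
      (fun t ht => hdΛ t ht.1) (fun t ht => (hl' t ht.1).1.const_mul _) fun t ht => ?_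
    refine (exp_neg_margin_le hN x (w t) k).trans ?_
    rw [div_mul_eq_mul_div, le_div_iff₀ hA0]
    have := mul_le_mul_of_nonneg_left (hl' t ht.1).2 hN'.le
    linarith
  have hphase2 : Λ T - Λ τ ≤
      -(exp (ρ * log N) / ((ρ - 1) * A) * exp (-((ρ - 1) * l T))) -
        -(exp (ρ * log N) / ((ρ - 1) * A) * exp (-((ρ - 1) * l τ))) := by
    refine sub_le_sub_of_hasDerivAt_le (f' := fun t => exp (-(∑ j, x k j * w t j)))
      (g' := fun t => -(exp (ρ * log N) / ((ρ - 1) * A) *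
        (exp (-((ρ - 1) * l t)) * -((ρ - 1) * l' t))))
      (g := fun t => -(exp (ρ * log N) / ((ρ - 1) * A) * exp (-((ρ - 1) * l t)))) hτ.2
      (fun t ht => hdΛ t (hτ.1.trans ht.1))
      (fun t ht => ((((hl' t (hτ.1.trans ht.1)).1.const_mul _).neg.exp).const_mul _).neg)
      fun t ht => ?_
    have ht0 := hτ.1.trans ht.1
    have h1 := hk t ⟨ht0, ht.2⟩ (hτB ▸ hmono _ _ hτ.1 ht.1) (hmono _ _ ht0 ht.2)
    have h2 := (hl' t ht0).2
    rw [hLexp] at h2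
    calc exp (-(∑ j, x k j * w t j))
        ≤ exp (ρ * log N + (-((ρ - 1) * l t) + -l t)) := by
          rw [exp_le_exp]
          simp only [hl] at h1 ⊢
          linarith
      _ = exp (ρ * log N) / A * exp (-((ρ - 1) * l t)) * (A * exp (-l t)) := by
          rw [exp_add, exp_add]
          field_simp
      _ ≤ exp (ρ * log N) / A * exp (-((ρ - 1) * l t)) * l' t := by gcongr
      _ = _ := by field_simp
  have hΛ0 : Λ 0 = 0 := primitive_zero _
  have hle1 : exp (-((ρ - 1) * l τ)) ≤ 1 := by
    rw [exp_le_one_iff, hτB]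
    have := mul_nonneg hρ'.le hB
    linarith
  have hΛT : Λ T ≤ (N * B + exp (ρ * log N) / (ρ - 1)) / A := by
    have h3 : exp (ρ * log N) / ((ρ - 1) * A) * exp (-((ρ - 1) * l τ)) ≤
        exp (ρ * log N) / ((ρ - 1) * A) := mul_le_of_le_one_right (by positivity) hle1
    have h4 : 0 ≤ exp (ρ * log N) / ((ρ - 1) * A) * exp (-((ρ - 1) * l T)) := by positivity
    have h5 : (N * B + exp (ρ * log N) / (ρ - 1)) / A =
        N / A * B + exp (ρ * log N) / ((ρ - 1) * A) := by field_simp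
    rw [h5]
    rw [hτB, hl0, hΛ0] at hphase1
    linarith
  calc dualVar x s α w T k = α ^ s * (((s + 2 : ℕ) : ℝ) / N * s) * Λ T := rfl
    _ ≤ α ^ s * (((s + 2 : ℕ) : ℝ) / N * s) *
        ((N * B + exp (ρ * log N) / (ρ - 1)) / A) := by gcongr
    _ = _ := by
      rw [hA, show 2 * s + 2 = s + (s + 2) by ring, pow_add α s (s + 2)]
      field_simp

end DiagFlow

theorem stmt12
    (d N D : ℕ) (hd : 0 < d) (hN : 0 < N) (hD : 2 < D)
    (x : Fin N → Fin d → ℝ)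
    (γ₂ : ℝ) (hγ₂pos : 0 < γ₂)
    (hγ₂ : IsGreatest {g : ℝ | ∃ v : Fin d → ℝ, (∑ i, (v i)^2) = 1 ∧ ∀ n, g ≤ ∑ i, x n i * v i} γ₂)
    (up um : ℝ → ℝ → Fin d → ℝ)
    (hinit : ∀ a : ℝ, 0 < a → ∀ i, up a 0 i = a ∧ um a 0 i = a)
    (w : ℝ → ℝ → Fin d → ℝ)
    (hw : ∀ a t i, w a t i = (up a t i)^D - (um a t i)^D)
    (Lf : ℝ → ℝ → ℝ)
    (hLf : ∀ a t, Lf a t = (1 / (N:ℝ)) * ∑ n, Real.exp (-(∑ i, x n i * w a t i)))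
    (hflowp : ∀ a : ℝ, 0 < a → ∀ t, 0 ≤ t → ∀ i, HasDerivAt (fun s => up a s i)
        (((D:ℝ)/(N:ℝ)) * (up a t i)^(D-1) * ∑ n, Real.exp (-(∑ j, x n j * w a t j)) * x n i) t)
    (hflowm : ∀ a : ℝ, 0 < a → ∀ t, 0 ≤ t → ∀ i, HasDerivAt (fun s => um a s i)
        (-(((D:ℝ)/(N:ℝ)) * (um a t i)^(D-1) * ∑ n, Real.exp (-(∑ j, x n j * w a t j)) * x n i)) t)
    (ε : ℝ → ℝ)
    (hεanti : StrictAntiOn ε (Set.Ioi (0:ℝ)))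
    (hεrange : ∀ a : ℝ, 0 < a → 0 < ε a ∧ ε a ≤ 1)
    (hεlim : Filter.Tendsto ε Filter.atTop (nhds 0))
    (T : ℝ → ℝ)
    (hT : ∀ a : ℝ, 0 < a → 0 ≤ T a ∧ Lf a (T a) = ε a)
    (γm : ℝ → ℝ → ℝ)
    (hγm : ∀ a t, IsLeast {g : ℝ | ∃ n : Fin N, g = ∑ i, x n i * w a t i} (γm a t))
    (what : Fin d → ℝ)
    (hlim : Filter.Tendsto (fun a => fun i => w a (T a) i / γm a (T a)) Filter.atTop (nhds what))
    (hfast : Filter.Tendsto (fun a => Real.log (1 / ε a) / a^D) Filter.atTop Filter.atTop)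
    (hstab : ∀ k : Fin N, 1 < (∑ i, x k i * what i) →
      ∃ γs : ℝ → ℝ, Filter.Tendsto (fun a => γs a / a^D) Filter.atTop (nhds 0) ∧
      ∃ ρ₀ : ℝ, 1 < ρ₀ ∧
      ∃ A : ℝ, ∀ a, A ≤ a → ∀ t, 0 ≤ t →
        γs a ≤ -Real.log (Lf a t) → -Real.log (Lf a t) ≤ Real.log (1 / ε a) →
        ρ₀ ≤ (∑ i, x k i * w a t i) / γm a t)
    :
    (∀ n, 1 ≤ ∑ i, x n i * what i) ∧
    ∀ v : Fin d → ℝ, (∀ n, 1 ≤ ∑ i, x n i * v i) →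
      (∑ i, |what i|) ≤ ∑ i, |v i| := by
  obtain ⟨s, rfl⟩ : ∃ s, D = s + 2 := ⟨D - 2, by omega⟩
  have hs : s ≠ 0 := by omega
  have hN' : (0 : ℝ) < N := by exact_mod_cast hN
  have hF : ∀ a, 0 < a → DiagFlow x s a (up a) (um a) (w a) := fun a ha =>
    ⟨fun i => (hinit a ha i).1, fun i => (hinit a ha i).2, hw a,
      fun t ht i => hflowp a ha t ht i, fun t ht i => hflowm a ha t ht i⟩
  have hL : ∀ a t, Lf a t = expLoss x (w a t) := hLf
  obtain ⟨⟨u, hu1, hu2⟩, -⟩ := hγ₂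
  have hγle : ∀ a t n, γm a t ≤ ∑ i, x n i * w a t i := fun a t n => (hγm a t).2 ⟨n, rfl⟩
  have hγlog : ∀ a t, -Real.log (Lf a t) - Real.log N ≤ γm a t := by
    intro a t
    obtain ⟨n, hn⟩ := (hγm a t).1
    rw [hn, hL]
    exact neg_log_expLoss_le_margin hN x (w a t) n
  have hlogT : ∀ a, 0 < a → -Real.log (Lf a (T a)) = Real.log (1 / ε a) := by
    intro a ha
    rw [(hT a ha).2, one_div, Real.log_inv]
  have hpow : Tendsto (fun a : ℝ => a ^ (s + 2)) atTop atTop :=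
    tendsto_pow_atTop (by omega)
  have hγdiv : Tendsto (fun a => γm a (T a) / a ^ (s + 2)) atTop atTop := by
    have h1 : Tendsto (fun a : ℝ => -(Real.log N / a ^ (s + 2))) atTop (𝓝 (-0)) :=
      (tendsto_const_nhds.div_atTop hpow).neg
    refine tendsto_atTop_mono' _ ?_ (hfast.atTop_add h1)
    filter_upwards [eventually_gt_atTop 0] with a ha
    rw [← hlogT a ha, ← sub_eq_add_neg, ← sub_div]
    have := hγlog a (T a)
    gcongr
  have hγpos : ∀ᶠ a in atTop, 0 < γm a (T a) := by
    filter_upwards [hγdiv.eventually_gt_atTop 0, eventually_gt_atTop 0] with a h ha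
    exact (div_pos_iff_of_pos_right (pow_pos ha _)).1 h
  have hlimi : ∀ i, Tendsto (fun a => w a (T a) i / γm a (T a)) atTop (𝓝 (what i)) :=
    tendsto_pi_nhds.1 hlim
  have hmargin : ∀ n, Tendsto (fun a => ∑ i, x n i * (w a (T a) i / γm a (T a))) atTop
      (𝓝 (∑ i, x n i * what i)) := fun n =>
    tendsto_finsetSum _ fun i _ => (hlimi i).const_mul _
  have hfeas : ∀ n, 1 ≤ ∑ i, x n i * what i := by
    intro n
    refine ge_of_tendsto (hmargin n) ?_
    filter_upwards [hγpos] with a ha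
    simp only [← mul_div_assoc, ← Finset.sum_div]
    rw [one_le_div ha]
    exact hγle a (T a) n
  refine ⟨hfeas, fun v hv => ?_⟩
  have hdual0 : ∀ᶠ a in atTop, ∀ n, 0 ≤ dualVar x s a (w a) (T a) n := by
    filter_upwards [eventually_gt_atTop 0] with a ha n
    exact DiagFlow.dualVar_nonneg ha (hT a ha).1 n
  have hdualsum : ∀ᶠ a in atTop, ∑ n, dualVar x s a (w a) (T a) n ≤ ∑ i, |v i| := by
    filter_upwards [eventually_gt_atTop 0] with a ha
    exact (hF a ha).sum_dualVar_le ha hs (hT a ha).1 hv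
  have hslack : ∀ k, 1 < ∑ i, x k i * what i →
      Tendsto (fun a => dualVar x s a (w a) (T a) k) atTop (𝓝 0) := by
    intro k hk
    obtain ⟨γs, hγs, ρ, hρ, A, hA⟩ := hstab k hk
    have hmax : Tendsto (fun a => max (γs a) 0 / a ^ (s + 2)) atTop (𝓝 0) := by
      have h := hγs.max (tendsto_const_nhds (x := (0 : ℝ)))
      rw [max_self] at h
      refine h.congr' ?_
      filter_upwards [eventually_gt_atTop 0] with a ha
      rw [← max_div_div_right (pow_pos ha _).le, zero_div]
    have hbound : Tendsto (fun a : ℝ => (((s + 2 : ℕ) : ℝ) / N * s) / γ₂ ^ 2 *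
        (N * (max (γs a) 0 / a ^ (s + 2)) +
          Real.exp (ρ * Real.log N) / (ρ - 1) / a ^ (s + 2))) atTop (𝓝 0) := by
      have h := ((hmax.const_mul (N : ℝ)).add ((tendsto_const_nhds
        (x := Real.exp (ρ * Real.log N) / (ρ - 1))).div_atTop hpow)).const_mul
          ((((s + 2 : ℕ) : ℝ) / N * s) / γ₂ ^ 2)
      simpa using h
    refine tendsto_of_tendsto_of_tendsto_of_le_of_le' tendsto_const_nhds hbound
      (hdual0.mono fun a h => h k) ?_
    filter_upwards [eventually_gt_atTop 0, eventually_ge_atTop A,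
      hmax.eventually_lt_const one_pos, hfast.eventually_gt_atTop 1] with a ha haA hm1 hf1
    have hap := pow_pos ha (s + 2)
    have hBT : max (γs a) 0 ≤ -Real.log (expLoss x (w a (T a))) := by
      rw [← hL, hlogT a ha]
      exact ((div_lt_div_iff_of_pos_right hap).1 (hm1.trans hf1)).le
    refine ((hF a ha).dualVar_le hN ha hs hγ₂pos hu1 hu2 (hT a ha).1 hρ (le_max_right _ _)
      hBT (k := k) ?_).trans_eq ?_
    · intro t ht h1 h2
      simp only [← hL] at h1 h2 ⊢
      have h3 := hA a haA t ht.1 ((le_max_left _ _).trans h1) (hlogT a ha ▸ h2)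
      have hγt : 0 < γm a t := by
        by_contra! hneg
        rcases hneg.lt_or_eq with hlt | heq
        · rw [le_div_iff_of_neg hlt] at h3
          have := hγle a t k
          nlinarith
        · rw [heq, div_zero] at h3
          linarith
      rw [le_div_iff₀ hγt] at h3
      exact (mul_le_mul_of_nonneg_left (hγlog a t) (by linarith)).trans h3
    · field_simp
  have hcross : ∀ n, Tendsto (fun a => dualVar x s a (w a) (T a) n *
      (∑ i, x n i * (w a (T a) i / γm a (T a)) - 1)) atTop (𝓝 0) := by
    intro n
    rcases (hfeas n).lt_or_eq with h | h
    · simpa using (hslack n h).mul ((hmargin n).sub_const 1)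
    · have h1 := (hmargin n).sub_const 1
      rw [← h, sub_self] at h1
      refine bdd_le_mul_tendsto_zero' (∑ i, |v i|) ?_ h1
      filter_upwards [hdual0, hdualsum] with a h0 hsum
      rw [abs_of_nonneg (h0 n)]
      exact (Finset.single_le_sum (fun n _ => h0 n) (Finset.mem_univ n)).trans hsum
  have hmain : ∀ M : ℝ, 1 ≤ M → (1 - 1 / M) * ∑ i, |what i| ≤ ∑ i, |v i| := by
    intro M hM
    have hlhs : Tendsto (fun a => (1 - 1 / M) * ∑ i, |w a (T a) i / γm a (T a)|) atTop
        (𝓝 ((1 - 1 / M) * ∑ i, |what i|)) :=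
      (tendsto_finsetSum _ fun i _ => (hlimi i).abs).const_mul _
    have hrhs : Tendsto (fun a => d * M ^ 2 * (γm a (T a) / a ^ (s + 2))⁻¹ +
        (∑ i, |v i| + ∑ n, dualVar x s a (w a) (T a) n *
          (∑ i, x n i * (w a (T a) i / γm a (T a)) - 1))) atTop (𝓝 (∑ i, |v i|)) := by
      have h := (hγdiv.inv_tendsto_atTop.const_mul (d * M ^ 2)).add
        ((tendsto_finsetSum Finset.univ fun n _ => hcross n).const_add (∑ i, |v i|))
      simpa using h
    refine le_of_tendsto_of_tendsto hlhs hrhs ?_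
    filter_upwards [hγpos, eventually_gt_atTop 0, hdualsum] with a hγ ha hsum
    have h := (hF a ha).l1_le ha hs (hT a ha).1 hM
    have e1 : ∑ i, |w a (T a) i / γm a (T a)| = (∑ i, |w a (T a) i|) / γm a (T a) := by
      simp only [abs_div, abs_of_pos hγ, Finset.sum_div]
    have e2 : ∑ n, dualVar x s a (w a) (T a) n *
          (∑ i, x n i * (w a (T a) i / γm a (T a)) - 1) =
        (∑ n, dualVar x s a (w a) (T a) n * ∑ i, x n i * w a (T a) i) / γm a (T a) -
          ∑ n, dualVar x s a (w a) (T a) n := by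
      simp only [mul_sub, mul_one, Finset.sum_sub_distrib, ← mul_div_assoc, ← Finset.sum_div]
    have h' := div_le_div_of_nonneg_right h hγ.le
    rw [add_div] at h'
    rw [e1, e2, inv_div, ← mul_div_assoc]
    have e3 : d * M ^ 2 * (a ^ (s + 2) / γm a (T a)) =
        d * (M ^ 2 * a ^ (s + 2)) / γm a (T a) := by ring
    rw [e3]
    linarith
  have hM : Tendsto (fun M : ℝ => (1 - 1 / M) * ∑ i, |what i|) atTop
      (𝓝 (∑ i, |what i|)) := by
    have h := ((tendsto_const_nhds (x := (1 : ℝ))).div_atTop tendsto_id).const_sub 1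
    simpa using h.mul_const (∑ i, |what i|)
  exact le_of_tendsto hM ((eventually_ge_atTop 1).mono hmain)
end

section
/- For the linearized (tangent-kernel) model, define κ(t) = w̄(t) − log( (2/N) D² α^{2D−2} t ) · w_{ℓ2} − w̃ for t > 0. Then for every γ̃₀ > 0 there exists a constant C′ (depending on the data, D, α and γ̃₀, but not on t) such that ‖κ(t)‖₂ ≤ C′ for all t with γ̄̃(t) ≥ γ̃₀. -/
open Real Finset Filter Topology MeasureTheory

theorem mul_exp_neg_le_one (z : ℝ) : z * exp (-z) ≤ 1 := by
  have h := mul_le_mul_of_nonneg_right (add_one_le_exp z) (exp_pos (-z)).le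
  rw [← exp_add, add_neg_cancel, exp_zero] at h
  nlinarith [exp_pos (-z)]

theorem mul_exp_neg_sub_one_nonpos (z : ℝ) : z * (exp (-z) - 1) ≤ 0 := by
  rcases le_total 0 z with h | h
  · exact mul_nonpos_of_nonneg_of_nonpos h (by linarith [exp_le_one_iff.2 (neg_nonpos.2 h)])
  · exact mul_nonpos_of_nonpos_of_nonneg h (by linarith [one_le_exp (neg_nonneg.2 h)])

/-- The contribution of a support vector to the derivative of `‖κ‖² / 2` is nonpositive. -/
theorem support_term_nonpos {c t ν z q : ℝ} (hc : 0 < c) (ht : 0 < t) (hν : exp (-q) = ν) :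
    (c * exp (-(z + log (c * t) + q)) - 1 / t * ν) * z ≤ 0 := by
  have hct : exp (log (c * t)) = c * t := exp_log (mul_pos hc ht)
  have h : (c * exp (-(z + log (c * t) + q)) - 1 / t * ν) * z
      = ν / t * (z * (exp (-z) - 1)) := by
    rw [neg_add, neg_add, exp_add, exp_add, exp_neg (log (c * t)), hct, hν]
    field_simp
  rw [h]
  have hν' : 0 < ν := hν ▸ exp_pos _
  exact mul_nonpos_of_nonneg_of_nonpos (by positivity) (mul_exp_neg_sub_one_nonpos z)

/-- The contribution of a non-support vector with margin `p > 1` to the derivative of `‖κ‖² / 2`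
is dominated by the decrease of `exp (-q) / (p - 1) * (c t) ^ (1 - p)`. -/
theorem nonsupport_term_nonpos {c t z p q : ℝ} (hc : 0 < c) (ht : 0 < t) (hp : 1 < p) :
    c * exp (-(z + log (c * t) * p + q)) * z
      + exp (-q) / (p - 1) * (exp ((1 - p) * log (c * t)) * ((1 - p) * (1 / t))) ≤ 0 := by
  have hct : exp (log (c * t)) = c * t := exp_log (mul_pos hc ht)
  have hp' : p - 1 ≠ 0 := by linarith
  have h1 : exp ((1 - p) * log (c * t)) = c * t * exp (-(log (c * t) * p)) := by
    rw [← hct, ← exp_add, hct]; ring_nf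
  have h : c * exp (-(z + log (c * t) * p + q)) * z
      + exp (-q) / (p - 1) * (exp ((1 - p) * log (c * t)) * ((1 - p) * (1 / t)))
      = c * exp (-(log (c * t) * p)) * exp (-q) * (z * exp (-z) - 1) := by
    rw [h1, neg_add, neg_add, exp_add, exp_add]
    field_simp
    ring
  rw [h]
  exact mul_nonpos_of_nonneg_of_nonpos (by positivity) (by linarith [mul_exp_neg_le_one z])

/-- A function whose derivative along `[δ, ∞)` is nonpositive is bounded by its value at `δ`. -/
theorem le_of_hasDerivAt_nonpos {F F' : ℝ → ℝ} {δ : ℝ}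
    (hF : ∀ t, δ ≤ t → HasDerivAt F (F' t) t) (hF' : ∀ t, δ ≤ t → F' t ≤ 0)
    {t : ℝ} (ht : δ ≤ t) : F t ≤ F δ := by
  have hanti : AntitoneOn F (Set.Ici δ) := by
    refine antitoneOn_of_deriv_nonpos (convex_Ici δ)
      (fun s hs => (hF s hs).continuousAt.continuousWithinAt)
      (fun s hs => (hF s (interior_subset hs)).differentiableAt.differentiableWithinAt)
      (fun s hs => ?_)
    rw [(hF s (interior_subset hs)).deriv]
    exact hF' s (interior_subset hs)
  exact hanti (Set.mem_Ici.2 le_rfl) ht ht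

/-- Along the exponential-loss flow, the residual `w(t) - log (c t) • u - v` stays bounded on
`[δ, ∞)` as soon as `u = ∑ μ n • x n`, where each `n` is either a support vector (margin one, with
multiplier matched by `v`) or has margin larger than one and vanishing multiplier. -/
theorem exists_residual_bound {ι κ : Type*} [Fintype ι] [Fintype κ] (x : ι → κ → ℝ)
    {c δ : ℝ} (hc : 0 < c) (hδ : 0 < δ) (w : ℝ → κ → ℝ)
    (hflow : ∀ t, 0 ≤ t → ∀ i, HasDerivAt (fun s => w s i)
      (c * ∑ n, exp (-(∑ j, x n j * w t j)) * x n i) t)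
    (u v : κ → ℝ) (μ : ι → ℝ) (hu : ∀ i, u i = ∑ n, μ n * x n i)
    (hμ : ∀ n, (∑ i, x n i * u i = 1 ∧ exp (-(∑ i, x n i * v i)) = μ n) ∨
      (1 < ∑ i, x n i * u i ∧ μ n = 0)) :
    ∃ C : ℝ, ∀ t, δ ≤ t → ∑ i, (w t i - log (c * t) * u i - v i) ^ 2 ≤ C := by
  set p : ι → ℝ := fun n => ∑ i, x n i * u i with hp
  set q : ι → ℝ := fun n => ∑ i, x n i * v i with hq
  let k : ℝ → κ → ℝ := fun t i => w t i - log (c * t) * u i - v i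
  let b : ι → ℝ := fun n => if p n = 1 then 0 else exp (-q n) / (p n - 1)
  have hp1 : ∀ n, 1 ≤ p n := fun n => (hμ n).elim (fun h => h.1.ge) (fun h => h.1.le)
  have hb : ∀ n, 0 ≤ b n := fun n => by
    dsimp only [b]
    split_ifs
    · exact le_rfl
    · exact div_nonneg (exp_pos _).le (by linarith [hp1 n])
  let F : ℝ → ℝ := fun t => ∑ i, k t i ^ 2 / 2 + ∑ n, b n * exp ((1 - p n) * log (c * t))
  let k' : ℝ → κ → ℝ := fun t i =>
    c * ∑ n, exp (-(∑ j, x n j * w t j)) * x n i - 1 / t * u i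
  let F' : ℝ → ℝ := fun t => ∑ i, k t i * k' t i +
    ∑ n, b n * (exp ((1 - p n) * log (c * t)) * ((1 - p n) * (1 / t)))
  have hlog : ∀ t : ℝ, 0 < t → HasDerivAt (fun s => log (c * s)) (1 / t) t := fun t ht => by
    have h := ((hasDerivAt_id' t).const_mul c).log (mul_pos hc ht).ne'
    convert h using 1
    field_simp
  have hk : ∀ t, 0 < t → ∀ i, HasDerivAt (fun s => k s i) (k' t i) t := fun t ht i =>
    ((hflow t ht.le i).sub ((hlog t ht).mul_const (u i))).sub_const (v i)
  have hF : ∀ t, δ ≤ t → HasDerivAt F (F' t) t := fun t ht => by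
    have ht0 := hδ.trans_le ht
    refine HasDerivAt.add (HasDerivAt.fun_sum fun i _ => ?_) (HasDerivAt.fun_sum fun n _ => ?_)
    · exact (((hk t ht0 i).fun_pow 2).div_const 2).congr_deriv (by push_cast; ring)
    · exact (((hlog t ht0).const_mul (1 - p n)).exp).const_mul (b n)
  have hF' : ∀ t, δ ≤ t → F' t ≤ 0 := fun t ht => by
    have ht0 := hδ.trans_le ht
    have hz : ∀ n, ∑ j, x n j * w t j = ∑ i, x n i * k t i + log (c * t) * p n + q n := fun n => by
      simp only [hp, hq, k, Finset.mul_sum, ← Finset.sum_add_distrib]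
      exact Finset.sum_congr rfl fun i _ => by ring
    have hsum : ∑ i, k t i * k' t i =
        ∑ n, (c * exp (-(∑ j, x n j * w t j)) - 1 / t * μ n) * ∑ i, x n i * k t i := by
      simp only [k', hu, Finset.mul_sum, ← Finset.sum_sub_distrib]
      rw [Finset.sum_comm]
      exact Finset.sum_congr rfl fun n _ => Finset.sum_congr rfl fun i _ => by ring
    dsimp only [F']
    rw [hsum, ← Finset.sum_add_distrib]
    refine Finset.sum_nonpos fun n _ => ?_
    rw [hz]
    rcases hμ n with ⟨h1, h2⟩ | ⟨h1, h2⟩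
    · have h1' : p n = 1 := h1
      have h := support_term_nonpos (z := ∑ i, x n i * k t i) hc ht0 h2
      simpa [b, h1'] using h
    · have h := nonsupport_term_nonpos (z := ∑ i, x n i * k t i) (q := q n) hc ht0 h1
      have hbn : b n = exp (-q n) / (p n - 1) := if_neg (ne_of_gt h1)
      rwa [h2, mul_zero, sub_zero, hbn]
  refine ⟨2 * F δ, fun t ht => ?_⟩
  have h := le_of_hasDerivAt_nonpos hF hF' ht
  have h0 : 0 ≤ ∑ n, b n * exp ((1 - p n) * log (c * t)) :=
    Finset.sum_nonneg fun n _ => mul_nonneg (hb n) (exp_pos _).le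
  have h2 : ∑ i, k t i ^ 2 / 2 ≤ F δ := by
    dsimp only [F] at h ⊢
    linarith
  rw [← Finset.sum_div] at h2
  change ∑ i, k t i ^ 2 ≤ _
  linarith

theorem stmt14
    (d N D : ℕ) (hd : 0 < d) (hN : 0 < N) (hD : 2 ≤ D)
    (x : Fin N → Fin d → ℝ)
    (γ₂ : ℝ) (hγ₂pos : 0 < γ₂)
    (hγ₂ : IsGreatest {g : ℝ | ∃ v : Fin d → ℝ, (∑ i, (v i)^2) = 1 ∧ ∀ n, g ≤ ∑ i, x n i * v i} γ₂)
    (α : ℝ) (hα : 0 < α)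
    (wb : ℝ → Fin d → ℝ)
    (hwb0 : ∀ i, wb 0 i = 0)
    (hflow : ∀ t, 0 ≤ t → ∀ i, HasDerivAt (fun s => wb s i)
        ((2/(N:ℝ)) * (D:ℝ)^2 * α^(2*D-2) * ∑ n, Real.exp (-(∑ j, x n j * wb t j)) * x n i) t)
    (wl2 : Fin d → ℝ)
    (hwl2feas : ∀ n, 1 ≤ ∑ i, x n i * wl2 i)
    (hwl2min : ∀ v : Fin d → ℝ, (∀ n, 1 ≤ ∑ i, x n i * v i) → v ≠ wl2 →
        (∑ i, (wl2 i)^2) < ∑ i, (v i)^2)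
    (ν : Fin N → ℝ)
    (hνpos : ∀ n, (∑ i, x n i * wl2 i) = 1 → 0 < ν n)
    (hrep : ∀ i, wl2 i = ∑ n, (if (∑ j, x n j * wl2 j) = 1 then ν n * x n i else 0))
    (θ : ℝ) (hθ : 1 < θ)
    (hθdef : IsLeast {g : ℝ | ∃ n : Fin N, (∑ i, x n i * wl2 i) ≠ 1 ∧ g = ∑ i, x n i * wl2 i} θ)
    (wt : Fin d → ℝ)
    (hwt : ∀ n, (∑ i, x n i * wl2 i) = 1 → Real.exp (-(∑ i, x n i * wt i)) = ν n)
    :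
    ∀ γ₀ : ℝ, 0 < γ₀ → ∃ C : ℝ, ∀ t : ℝ, 0 ≤ t →
      γ₀ ≤ -Real.log ((1/(N:ℝ)) * ∑ n, Real.exp (-(∑ i, x n i * wb t i))) →
      Real.sqrt (∑ i,
        (wb t i - Real.log ((2/(N:ℝ)) * (D:ℝ)^2 * α^(2*D-2) * t) * wl2 i - wt i)^2) ≤ C := by
  intro γ₀ hγ₀
  have hNpos : (0 : ℝ) < N := Nat.cast_pos.2 hN
  have hDpos : (0 : ℝ) < D := Nat.cast_pos.2 (by omega)
  have hc : 0 < (2 / (N : ℝ)) * (D : ℝ) ^ 2 * α ^ (2 * D - 2) := by positivity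
  have hcont : ContinuousAt (fun t => -Real.log ((1 / (N : ℝ)) *
      ∑ n, Real.exp (-(∑ i, x n i * wb t i)))) 0 := by
    have hw : ∀ i, ContinuousAt (fun s => wb s i) 0 := fun i => (hflow 0 le_rfl i).continuousAt
    refine (ContinuousAt.log (by fun_prop) ?_).neg
    have : Nonempty (Fin N) := ⟨⟨0, hN⟩⟩
    exact (mul_pos (by positivity)
      (Finset.sum_pos (fun n _ => Real.exp_pos _) Finset.univ_nonempty)).ne'
  have hzero : -Real.log ((1 / (N : ℝ)) * ∑ n, Real.exp (-(∑ i, x n i * wb 0 i))) < γ₀ := by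
    simpa [hwb0, hNpos.ne'] using hγ₀
  obtain ⟨δ, hδ, hδlt⟩ := Metric.eventually_nhds_iff.1 (hcont.eventually_lt_const hzero)
  obtain ⟨C, hC⟩ := exists_residual_bound x hc hδ wb hflow wl2 wt
    (fun n => if (∑ j, x n j * wl2 j) = 1 then ν n else 0)
    (fun i => by simp only [hrep i, ite_mul, zero_mul])
    (fun n => by
      by_cases h : ∑ i, x n i * wl2 i = 1
      · exact Or.inl ⟨h, by simpa [h] using hwt n h⟩
      · exact Or.inr ⟨lt_of_le_of_ne (hwl2feas n) (Ne.symm h), by simp [h]⟩)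
  refine ⟨Real.sqrt C, fun t ht hγ => Real.sqrt_le_sqrt (hC t ?_)⟩
  by_contra hlt
  refine (hδlt (y := t) ?_).not_ge hγ
  rw [Real.dist_eq, sub_zero, abs_of_nonneg ht]
  exact not_le.1 hlt
end
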